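/- There exists an absolute constant c > 0 such that for all finite nonempty sets A and X of positive real numbers, |AX+AX| ≥ c·|X|·|A/A|^(1/2)·K^(1/8), where K = |X|³ / E₊(X); equivalently, |AX+AX|⁸·E₊(X) ≥ c⁸·|X|^11·|A/A|⁴. -/

import Mathlib

/-- The additive energy of a finite set of reals: the number of quadruples
`(x₁,x₂,x₃,x₄) ∈ X⁴` with `x₁ + x₂ = x₃ + x₄`. -/
noncomputable def addEnergy (X : Finset ℝ) : ℕ :=
  ((X ×ˢ X ×ˢ X ×ˢ X).filter
    (fun p : ℝ × ℝ × ℝ × ℝ => p.1 + p.2.1 = p.2.2.1 + p.2.2.2)).card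

open Finset hiding addEnergy addEnergy_pos

/-- The number of pairs with equal images, counted fibre by fibre. -/
theorem card_filter_eq_sum_fiber {α β γ : Type*} [DecidableEq γ] (s : Finset α) (t : Finset β)
    (f : α → γ) (g : β → γ) (R : Finset γ) (hf : ∀ p ∈ s, f p ∈ R) :
    ((s ×ˢ t).filter (fun p => f p.1 = g p.2)).card =
      ∑ d ∈ R, (s.filter (fun p => f p = d)).card * (t.filter (fun q => g q = d)).card := by
  rw [card_eq_sum_card_fiberwise (f := fun p : α × β => f p.1) (t := R)]
  · refine sum_congr rfl fun d _ => ?_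
    rw [← card_product]
    congr 1
    ext ⟨p, q⟩
    simp only [mem_filter, mem_product]
    constructor
    · rintro ⟨⟨⟨hp, hq⟩, h⟩, hd⟩
      exact ⟨⟨hp, hd⟩, hq, h ▸ hd⟩
    · rintro ⟨⟨hp, hd⟩, hq, h⟩
      exact ⟨⟨⟨hp, hq⟩, hd.trans h.symm⟩, hd⟩
  · intro p hp
    simp only [coe_filter, mem_product, Set.mem_ofPred_eq] at hp
    exact hf _ hp.1.1

/-- Cauchy-Schwarz: few values force many collisions. -/
theorem card_sq_le_card_mul_collisions {α γ : Type*} [DecidableEq γ] (s : Finset α) (f : α → γ)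
    (R : Finset γ) (hf : ∀ p ∈ s, f p ∈ R) :
    s.card ^ 2 ≤ R.card * ((s ×ˢ s).filter (fun p => f p.1 = f p.2)).card := by
  rw [card_filter_eq_sum_fiber s s f f R hf, card_eq_sum_card_fiberwise (f := f) (t := R) hf]
  have := sq_sum_le_card_mul_sum_sq (s := R) (f := fun d => (s.filter (fun p => f p = d)).card)
  simp only [← pow_two]
  exact_mod_cast this

theorem two_mul_card_filter_eq_le {α γ : Type*} [DecidableEq γ] (s : Finset α) (f g : α → γ) :
    2 * ((s ×ˢ s).filter (fun p => f p.1 = g p.2)).card ≤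
      ((s ×ˢ s).filter (fun p => f p.1 = f p.2)).card +
        ((s ×ˢ s).filter (fun p => g p.1 = g p.2)).card := by
  have hf : ∀ p ∈ s, f p ∈ s.image f ∪ s.image g := fun p hp =>
    mem_union_left _ (mem_image_of_mem f hp)
  have hg : ∀ p ∈ s, g p ∈ s.image f ∪ s.image g := fun p hp =>
    mem_union_right _ (mem_image_of_mem g hp)
  rw [card_filter_eq_sum_fiber s s f g _ hf, card_filter_eq_sum_fiber s s f f _ hf,
    card_filter_eq_sum_fiber s s g g _ hg, mul_sum, ← sum_add_distrib]
  refine sum_le_sum fun d _ => ?_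
  have := two_mul_le_add_sq (s.filter (fun p => f p = d)).card (s.filter (fun p => g p = d)).card
  nlinarith

theorem card_dilated_differences_eq (X : Finset ℝ) {r : ℝ} (hr : r ≠ 0) :
    (((X ×ˢ X) ×ˢ (X ×ˢ X)).filter
      (fun p => r * (p.1.1 - p.1.2) = r * (p.2.1 - p.2.2))).card = addEnergy X := by
  unfold addEnergy
  refine card_bij' (fun p _ => (p.1.1, p.2.2, p.2.1, p.1.2))
    (fun p _ => ((p.1, p.2.2.2), (p.2.2.1, p.2.1))) ?_ ?_ ?_ ?_
  · rintro ⟨⟨a, b⟩, c, d⟩ h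
    simp only [mem_filter, mem_product, mul_right_inj' hr] at h ⊢
    exact ⟨⟨h.1.1.1, h.1.2.2, h.1.2.1, h.1.1.2⟩, by linarith [h.2]⟩
  · rintro ⟨a, b, c, d⟩ h
    simp only [mem_filter, mem_product, mul_right_inj' hr] at h ⊢
    exact ⟨⟨⟨h.1.1, h.1.2.2.2⟩, h.1.2.2.1, h.1.2.1⟩, by linarith [h.2]⟩
  · intros; rfl
  · intros; rfl

/-- The energy between two dilates of a set is at most the energy of the set. -/
theorem card_dilate_energy_le (X : Finset ℝ) {r s : ℝ} (hr : r ≠ 0) (hs : s ≠ 0) :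
    (((X ×ˢ X) ×ˢ (X ×ˢ X)).filter
      (fun p => r * p.1.1 + s * p.1.2 = r * p.2.1 + s * p.2.2)).card ≤ addEnergy X := by
  have h := two_mul_card_filter_eq_le (X ×ˢ X) (fun p => r * (p.1 - p.2))
    (fun p => s * (p.1 - p.2))
  rw [card_dilated_differences_eq X hr, card_dilated_differences_eq X hs] at h
  refine le_trans (card_le_card_of_injOn (fun p => ((p.1.1, p.2.1), (p.2.2, p.1.2))) ?_ ?_)
    (Nat.le_of_mul_le_mul_left (h.trans_eq (two_mul _).symm) two_pos)
  · rintro ⟨⟨a, b⟩, c, d⟩ h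
    simp only [coe_filter, Set.mem_ofPred_eq, mem_product] at h ⊢
    exact ⟨⟨⟨h.1.1.1, h.1.2.1⟩, h.1.2.2, h.1.1.2⟩, by linarith [h.2]⟩
  · rintro ⟨⟨a, b⟩, c, d⟩ _ ⟨⟨a', b'⟩, c', d'⟩ _ h
    simp only [Prod.mk.injEq] at h ⊢
    tauto

theorem card_linear_solutions_sq_le (X : Finset ℝ) {r s t : ℝ} (hr : r ≠ 0) (hs : s ≠ 0)
    (ht : t ≠ 0) :
    ((X ×ˢ X ×ˢ X).filter (fun p => r * p.1 + s * p.2.1 = t * p.2.2)).card ^ 2 ≤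
      X.card * addEnergy X := by
  refine (card_sq_le_card_mul_collisions _ (fun p => p.2.2) X ?_).trans
    (Nat.mul_le_mul_left _ (le_trans (card_le_card_of_injOn
      (fun p => ((p.1.1, p.1.2.1), (p.2.1, p.2.2.1))) ?_ ?_) (card_dilate_energy_le X hr hs)))
  · intro p hp
    simp only [mem_filter, mem_product] at hp
    exact hp.1.2.2
  · rintro ⟨⟨a, b, c⟩, a', b', c'⟩ h
    simp only [coe_filter, Set.mem_ofPred_eq, mem_product, mem_filter] at h ⊢
    obtain ⟨⟨⟨⟨ha, hb, hc⟩, e⟩, ⟨⟨ha', hb', hc'⟩, e'⟩⟩, rfl⟩ := h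
    exact ⟨⟨⟨ha, hb⟩, ha', hb'⟩, e.trans e'.symm⟩
  · rintro ⟨⟨a, b, c⟩, a', b', c'⟩ h ⟨⟨d, e, f⟩, d', e', f'⟩ h' heq
    simp only [coe_filter, Set.mem_ofPred_eq, mem_product, mem_filter, Prod.mk.injEq] at h h' heq ⊢
    obtain ⟨⟨⟨-, e1⟩, -⟩, rfl⟩ := h
    obtain ⟨⟨⟨-, e2⟩, -⟩, rfl⟩ := h'
    obtain ⟨⟨rfl, rfl⟩, rfl, rfl⟩ := heq
    have := mul_left_cancel₀ ht (e1.symm.trans e2)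
    subst this
    simp

theorem addEnergy_le_card_cube (X : Finset ℝ) : addEnergy X ≤ X.card ^ 3 := by
  have : X.card ^ 3 = (X ×ˢ X ×ˢ X).card := by simp only [card_product]; ring
  rw [this]
  refine card_le_card_of_injOn (fun p => (p.1, p.2.1, p.2.2.1)) ?_ ?_
  · rintro ⟨a, b, c, d⟩ h
    simp only [coe_filter, Set.mem_ofPred_eq, mem_product, mem_coe] at h ⊢
    tauto
  · rintro ⟨a, b, c, d⟩ h ⟨a', b', c', d'⟩ h' e
    simp only [coe_filter, Set.mem_ofPred_eq, mem_product, Prod.mk.injEq] at h h' e ⊢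
    obtain ⟨rfl, rfl, rfl⟩ := e
    exact ⟨rfl, rfl, rfl, by linarith [h.2, h'.2]⟩

theorem addEnergy_pos {X : Finset ℝ} (hX : X.Nonempty) : 0 < addEnergy X := by
  obtain ⟨x, hx⟩ := hX
  exact card_pos.2 ⟨(x, x, x, x), by simp [hx]⟩

/-- Cauchy-Schwarz for the map `(x, y) ↦ a x + a y`. -/
theorem card_pow_four_le_mul_addEnergy (X R : Finset ℝ) {a : ℝ} (ha : a ≠ 0)
    (h : ∀ x ∈ X, ∀ y ∈ X, a * x + a * y ∈ R) : X.card ^ 4 ≤ R.card * addEnergy X := by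
  have h1 := card_sq_le_card_mul_collisions (X ×ˢ X) (fun p => a * p.1 + a * p.2) R
    (fun p hp => h _ (mem_product.1 hp).1 _ (mem_product.1 hp).2)
  have h2 := card_dilate_energy_le X ha ha
  rw [card_product] at h1
  calc X.card ^ 4 = (X.card * X.card) ^ 2 := by ring
    _ ≤ _ := h1
    _ ≤ _ := Nat.mul_le_mul_left _ h2

/-- The sum of the points with abscissae `b s * x` and `b t * y` on the lines through the origin of
slopes `s` and `t`. -/
def lineSum (b : ℝ → ℝ) (p w : ℝ × ℝ) : ℝ × ℝ :=
  (b p.1 * w.1 + b p.2 * w.2, p.1 * (b p.1 * w.1) + p.2 * (b p.2 * w.2))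

theorem lineSum_injective {b : ℝ → ℝ} {p : ℝ × ℝ} (h1 : b p.1 ≠ 0) (h2 : b p.2 ≠ 0)
    (hp : p.1 ≠ p.2) : Function.Injective (lineSum b p) := by
  rintro ⟨x, y⟩ ⟨x', y'⟩ h
  simp only [lineSum, Prod.mk.injEq] at h ⊢
  obtain ⟨e1, e2⟩ := h
  constructor
  · apply mul_left_cancel₀ (mul_ne_zero h1 (sub_ne_zero.2 hp))
    linear_combination e2 - p.2 * e1
  · apply mul_left_cancel₀ (mul_ne_zero h2 (sub_ne_zero.2 hp))
    linear_combination p.1 * e1 - e2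

theorem card_lineSum_collisions_sq_le (X : Finset ℝ) {b : ℝ → ℝ} {p q : ℝ × ℝ}
    (hb1 : b p.1 ≠ 0) (hb2 : b p.2 ≠ 0) (hb3 : b q.1 ≠ 0) (hb4 : b q.2 ≠ 0)
    (h12 : p.1 ≠ q.2) (h21 : p.2 ≠ q.1) (hq : q.1 ≠ q.2) (hpq : p ≠ q) :
    (((X ×ˢ X) ×ˢ (X ×ˢ X)).filter
      (fun w => lineSum b p w.1 = lineSum b q w.2)).card ^ 2 ≤ X.card * addEnergy X := by
  by_cases h : p.2 = q.2
  · have h' : p.1 ≠ q.1 := fun h' => hpq (Prod.ext h' h)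
    refine le_trans (Nat.pow_le_pow_left (card_le_card_of_injOn
      (fun w => (w.1.1, w.1.2, w.2.2)) ?_ ?_) 2) (card_linear_solutions_sq_le X
        (mul_ne_zero hb1 (sub_ne_zero.2 h')) (mul_ne_zero hb2 (sub_ne_zero.2 h21))
        (mul_ne_zero hb4 (sub_ne_zero.2 hq.symm)))
    · rintro ⟨⟨x, y⟩, x', y'⟩ h
      simp only [coe_filter, Set.mem_ofPred_eq, mem_product, lineSum, Prod.mk.injEq] at h ⊢
      obtain ⟨⟨⟨hx, hy⟩, hx', hy'⟩, e1, e2⟩ := h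
      exact ⟨⟨hx, hy, hy'⟩, by linear_combination e2 - q.1 * e1⟩
    · rintro ⟨⟨x, y⟩, z, w⟩ h ⟨⟨x', y'⟩, z', w'⟩ h' e
      simp only [coe_filter, Set.mem_ofPred_eq, Prod.mk.injEq] at h h' e ⊢
      obtain ⟨rfl, rfl, rfl⟩ := e
      have := lineSum_injective hb3 hb4 hq (h.2.symm.trans h'.2)
      simpa using this
  · refine le_trans (Nat.pow_le_pow_left (card_le_card_of_injOn
      (fun w => (w.1.1, w.1.2, w.2.1)) ?_ ?_) 2) (card_linear_solutions_sq_le X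
        (mul_ne_zero hb1 (sub_ne_zero.2 h12)) (mul_ne_zero hb2 (sub_ne_zero.2 h))
        (mul_ne_zero hb3 (sub_ne_zero.2 hq)))
    · rintro ⟨⟨x, y⟩, x', y'⟩ h
      simp only [coe_filter, Set.mem_ofPred_eq, mem_product, lineSum, Prod.mk.injEq] at h ⊢
      obtain ⟨⟨⟨hx, hy⟩, hx', hy'⟩, e1, e2⟩ := h
      exact ⟨⟨hx, hy, hx'⟩, by linear_combination e2 - q.2 * e1⟩
    · rintro ⟨⟨x, y⟩, z, w⟩ h ⟨⟨x', y'⟩, z', w'⟩ h' e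
      simp only [coe_filter, Set.mem_ofPred_eq, Prod.mk.injEq] at h h' e ⊢
      obtain ⟨rfl, rfl, rfl⟩ := e
      have := lineSum_injective hb3 hb4 hq (h.2.symm.trans h'.2)
      simpa using this

/-- A cluster of `m` lower and `m` upper lines yields many sums of points. -/
theorem card_mul_card_le_of_cluster (X L U : Finset ℝ) (R : Finset (ℝ × ℝ)) (b : ℝ → ℝ) (m : ℕ)
    (hm : 1 ≤ m) (hX : X.Nonempty) (hmX : m ^ 4 * addEnergy X ≤ X.card ^ 3)
    (hL : L.card = m) (hU : U.card = m) (hLU : ∀ s ∈ L, ∀ t ∈ U, s < t)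
    (hbL : ∀ s ∈ L, b s ≠ 0) (hbU : ∀ s ∈ U, b s ≠ 0)
    (hR : ∀ s ∈ L, ∀ t ∈ U, ∀ x ∈ X, ∀ y ∈ X, lineSum b (s, t) (x, y) ∈ R) :
    m ^ 2 * X.card ^ 2 ≤ 2 * R.card := by
  set T := Nat.sqrt (X.card * addEnergy X) with hT
  have hTT : T ^ 2 ≤ X.card * addEnergy X := Nat.sqrt_le' _
  have hfib : ∀ p ∈ L ×ˢ U, ∀ q ∈ L ×ˢ U, (((X ×ˢ X) ×ˢ (X ×ˢ X)).filter
      (fun w => lineSum b p w.1 = lineSum b q w.2)).card ≤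
        (if p = q then X.card ^ 2 else 0) + T := by
    intro p hp q hq
    rw [mem_product] at hp hq
    split_ifs with h
    · subst h
      refine le_trans ?_ (Nat.le_add_right _ _)
      rw [pow_two, ← card_product]
      refine card_le_card_of_injOn Prod.fst ?_ ?_
      · intro w hw
        simp only [coe_filter, Set.mem_ofPred_eq, mem_product, mem_coe] at hw ⊢
        exact hw.1.1
      · rintro ⟨w, w'⟩ h ⟨z, z'⟩ h' e
        simp only [coe_filter, Set.mem_ofPred_eq] at h h' e
        have hi := lineSum_injective (hbL _ hp.1) (hbU _ hp.2) (hLU _ hp.1 _ hp.2).ne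
        have e1 := hi h.2
        have e2 := hi h'.2
        subst e1 e2 e
        rfl
    · rw [zero_add, hT, Nat.le_sqrt']
      exact card_lineSum_collisions_sq_le X (hbL _ hp.1) (hbU _ hp.2) (hbL _ hq.1) (hbU _ hq.2)
        (hLU _ hp.1 _ hq.2).ne (hLU _ hq.1 _ hp.2).ne' (hLU _ hq.1 _ hq.2).ne h
  have hcs := card_sq_le_card_mul_collisions ((L ×ˢ U) ×ˢ (X ×ˢ X)) (fun p => lineSum b p.1 p.2) R
    (by
      rintro ⟨⟨s, t⟩, x, y⟩ h
      simp only [mem_product] at h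
      exact hR s h.1.1 t h.1.2 x h.2.1 y h.2.2)
  have hcol : ((((L ×ˢ U) ×ˢ (X ×ˢ X)) ×ˢ ((L ×ˢ U) ×ˢ (X ×ˢ X))).filter
      (fun p => lineSum b p.1.1 p.1.2 = lineSum b p.2.1 p.2.2)).card ≤
        m ^ 2 * X.card ^ 2 + m ^ 4 * T := by
    rw [card_eq_sum_card_fiberwise (f := fun p => (p.1.1, p.2.1)) (t := (L ×ˢ U) ×ˢ (L ×ˢ U))]
    · calc _ ≤ ∑ pq ∈ (L ×ˢ U) ×ˢ (L ×ˢ U), ((if pq.1 = pq.2 then X.card ^ 2 else 0) + T) := by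
            refine sum_le_sum fun pq hpq => ?_
            rw [mem_product] at hpq
            refine le_trans (card_le_card_of_injOn (fun w => (w.1.2, w.2.2)) ?_ ?_)
              (hfib _ hpq.1 _ hpq.2)
            · rintro ⟨⟨p, w⟩, q, z⟩ h
              simp only [coe_filter, mem_filter, Set.mem_ofPred_eq, mem_product] at h ⊢
              obtain ⟨⟨⟨⟨-, hw⟩, -, hz⟩, e⟩, rfl⟩ := h
              exact ⟨⟨hw, hz⟩, e⟩
            · rintro ⟨⟨p, w⟩, q, z⟩ h ⟨⟨p', w'⟩, q', z'⟩ h' e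
              simp only [coe_filter, mem_filter, Set.mem_ofPred_eq, Prod.mk.injEq] at h h' e ⊢
              have e1 := h.2
              have e2 := h'.2
              simp only [← e1, Prod.mk.injEq] at e2
              exact ⟨⟨e2.1.symm, e.1⟩, e2.2.symm, e.2⟩
        _ = m ^ 2 * X.card ^ 2 + m ^ 4 * T := by
            rw [sum_add_distrib, sum_product]
            simp only [sum_ite_eq, sum_const, smul_eq_mul, card_product, hL, hU, sum_ite_mem,
              inter_self]
            ring
    · rintro ⟨⟨p, w⟩, q, z⟩ h
      simp only [coe_filter, Set.mem_ofPred_eq, mem_product, mem_coe] at h ⊢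
      exact ⟨h.1.1.1, h.1.2.1⟩
  have hXp : 0 < X.card := hX.card_pos
  have hmT : m ^ 2 * T ≤ X.card ^ 2 := by
    apply (Nat.pow_le_pow_iff_left two_ne_zero).1
    calc (m ^ 2 * T) ^ 2 = m ^ 4 * T ^ 2 := by ring
      _ ≤ m ^ 4 * (X.card * addEnergy X) := Nat.mul_le_mul_left _ hTT
      _ = X.card * (m ^ 4 * addEnergy X) := by ring
      _ ≤ X.card * X.card ^ 3 := Nat.mul_le_mul_left _ hmX
      _ = (X.card ^ 2) ^ 2 := by ring
  have hpos : 0 < m ^ 2 * X.card ^ 2 := by positivity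
  refine Nat.le_of_mul_le_mul_left ?_ hpos
  simp only [card_product, hL, hU] at hcs
  calc m ^ 2 * X.card ^ 2 * (m ^ 2 * X.card ^ 2) = (m * m * (X.card * X.card)) ^ 2 := by ring
    _ ≤ _ := hcs
    _ ≤ R.card * (m ^ 2 * X.card ^ 2 + m ^ 4 * T) := Nat.mul_le_mul_left _ hcol
    _ = R.card * (m ^ 2 * X.card ^ 2 + m ^ 2 * (m ^ 2 * T)) := by ring
    _ ≤ R.card * (m ^ 2 * X.card ^ 2 + m ^ 2 * X.card ^ 2) := by gcongr
    _ = _ := by ring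

theorem lineSum_between {b : ℝ → ℝ} {s t x y : ℝ} (hs : 0 < b s) (ht : 0 < b t) (hst : s < t)
    (hx : 0 < x) (hy : 0 < y) :
    0 < (lineSum b (s, t) (x, y)).1 ∧
      s * (lineSum b (s, t) (x, y)).1 < (lineSum b (s, t) (x, y)).2 ∧
      (lineSum b (s, t) (x, y)).2 < t * (lineSum b (s, t) (x, y)).1 := by
  have h1 := mul_pos hs hx
  have h2 := mul_pos ht hy
  simp only [lineSum]
  exact ⟨by positivity, by nlinarith, by nlinarith⟩

/-- Summing over disjoint clusters of `2 * m` consecutive slopes. -/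
theorem card_div_mul_le_of_slopes (X Q D : Finset ℝ) (b : ℝ → ℝ) (m : ℕ)
    (hm : 1 ≤ m) (hX : X.Nonempty) (hXpos : ∀ x ∈ X, 0 < x)
    (hmX : m ^ 4 * addEnergy X ≤ X.card ^ 3) (hb : ∀ s ∈ Q, 0 < b s)
    (hD : ∀ s ∈ Q, ∀ t ∈ Q, ∀ x ∈ X, ∀ y ∈ X, lineSum b (s, t) (x, y) ∈ D ×ˢ D) :
    Q.card / (2 * m) * (m ^ 2 * X.card ^ 2) ≤ 2 * D.card ^ 2 := by
  set n := Q.card with hn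
  let e := Q.orderEmbOfFin hn.symm
  let f : ℕ → ℝ := fun i => if h : i < n then e ⟨i, h⟩ else 0
  have hfQ : ∀ i < n, f i ∈ Q := fun i hi => by
    simp only [f, hi, dif_pos]
    exact orderEmbOfFin_mem _ _ _
  have hflt : ∀ i j, i < j → j < n → f i < f j := fun i j hij hj => by
    simp only [f, hj, hij.trans hj, dif_pos]
    exact e.strictMono hij
  have hfle : ∀ i j, i ≤ j → j < n → f i ≤ f j := fun i j hij hj => by
    rcases hij.eq_or_lt with rfl | h
    · exact le_rfl
    · exact (hflt i j h hj).le
  have hinj : ∀ k, k + m ≤ n → ((range m).image (fun i => f (k + i))).card = m := fun k hk => by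
    rw [card_image_of_injOn, card_range]
    intro i hi j hj hij
    simp only [coe_range, Set.mem_Iio] at hi hj
    rcases lt_trichotomy i j with h | h | h
    · exact absurd hij (hflt _ _ (by omega) (by omega)).ne
    · exact h
    · exact absurd hij (hflt _ _ (by omega) (by omega)).ne'
  have hbd : ∀ c < n / (2 * m), 2 * m * c + 2 * m ≤ n := fun c hc => by
    calc 2 * m * c + 2 * m = 2 * m * (c + 1) := by ring
      _ ≤ 2 * m * (n / (2 * m)) := Nat.mul_le_mul_left _ hc
      _ ≤ n := Nat.mul_div_le _ _
  let R : ℕ → Finset (ℝ × ℝ) := fun c => (D ×ˢ D).filter fun z =>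
    0 < z.1 ∧ f (2 * m * c) * z.1 < z.2 ∧ z.2 < f (2 * m * c + (2 * m - 1)) * z.1
  have hcl : ∀ c ∈ range (n / (2 * m)), m ^ 2 * X.card ^ 2 ≤ 2 * (R c).card := by
    intro c hc
    have hc' := hbd c (mem_range.1 hc)
    have hLm : ∀ s ∈ (range m).image (fun i => f (2 * m * c + i)), ∃ i < m,
        f (2 * m * c + i) = s := by simp
    have hUm : ∀ s ∈ (range m).image (fun i => f (2 * m * c + m + i)), ∃ i < m,
        f (2 * m * c + m + i) = s := by simp
    refine card_mul_card_le_of_cluster X ((range m).image (fun i => f (2 * m * c + i)))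
      ((range m).image (fun i => f (2 * m * c + m + i))) (R c) b m hm hX hmX
      (hinj _ (by omega)) (hinj _ (by omega)) ?_ ?_ ?_ ?_
    · intro s hs t ht
      obtain ⟨i, hi, rfl⟩ := hLm s hs
      obtain ⟨j, hj, rfl⟩ := hUm t ht
      exact hflt _ _ (by omega) (by omega)
    · intro s hs
      obtain ⟨i, hi, rfl⟩ := hLm s hs
      exact (hb _ (hfQ _ (by omega))).ne'
    · intro s hs
      obtain ⟨i, hi, rfl⟩ := hUm s hs
      exact (hb _ (hfQ _ (by omega))).ne'
    · intro s hs t ht x hx y hy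
      obtain ⟨i, hi, rfl⟩ := hLm s hs
      obtain ⟨j, hj, rfl⟩ := hUm t ht
      have hsQ := hfQ (2 * m * c + i) (by omega)
      have htQ := hfQ (2 * m * c + m + j) (by omega)
      obtain ⟨h0, h1, h2⟩ := lineSum_between (hb _ hsQ) (hb _ htQ)
        (hflt _ _ (by omega) (by omega)) (hXpos x hx) (hXpos y hy)
      refine mem_filter.2 ⟨hD _ hsQ _ htQ x hx y hy, h0, lt_of_le_of_lt ?_ h1,
        lt_of_lt_of_le h2 ?_⟩
      · exact mul_le_mul_of_nonneg_right (hfle _ _ (by omega) (by omega)) h0.le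
      · exact mul_le_mul_of_nonneg_right (hfle _ _ (by omega) (by omega)) h0.le
  have hlt : ∀ c c', c < c' → c' < n / (2 * m) → Disjoint (R c) (R c') := by
    intro c c' hcc hc'
    rw [disjoint_left]
    intro z hz hz'
    obtain ⟨-, h0, -, h1⟩ := mem_filter.1 hz
    obtain ⟨-, -, h2, -⟩ := mem_filter.1 hz'
    have hn' := hbd c' hc'
    have hidx : 2 * m * c + 2 * m ≤ 2 * m * c' := by
      calc 2 * m * c + 2 * m = 2 * m * (c + 1) := by ring
        _ ≤ 2 * m * c' := Nat.mul_le_mul_left _ hcc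
    have := mul_le_mul_of_nonneg_right
      (hfle (2 * m * c + (2 * m - 1)) (2 * m * c') (by omega) (by omega)) h0.le
    linarith
  have hdisj : ∀ c ∈ range (n / (2 * m)), ∀ c' ∈ range (n / (2 * m)), c ≠ c' →
      Disjoint (R c) (R c') := by
    intro c hc c' hc' hne
    rcases hne.lt_or_gt with h | h
    · exact hlt c c' h (mem_range.1 hc')
    · exact (hlt c' c h (mem_range.1 hc)).symm
  calc n / (2 * m) * (m ^ 2 * X.card ^ 2)
      = ∑ _c ∈ range (n / (2 * m)), m ^ 2 * X.card ^ 2 := by simp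
    _ ≤ ∑ c ∈ range (n / (2 * m)), 2 * (R c).card := sum_le_sum hcl
    _ = 2 * ((range (n / (2 * m))).biUnion R).card := by rw [← mul_sum, card_biUnion hdisj]
    _ ≤ 2 * (D ×ˢ D).card := by
        gcongr
        exact biUnion_subset.2 fun c _ => filter_subset _ _
    _ = 2 * D.card ^ 2 := by rw [card_product, pow_two]

theorem exists_pow_four_mul_le_lt {x E : ℕ} (hE : 0 < E) (h : E ≤ x) :
    ∃ m : ℕ, 1 ≤ m ∧ m ^ 4 * E ≤ x ∧ x ≤ 16 * m ^ 4 * E := by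
  have hx : 1 ≤ x := hE.trans_le h
  refine ⟨Nat.findGreatest (fun m => m ^ 4 * E ≤ x) x,
    Nat.le_findGreatest hx (by simpa using h),
    Nat.findGreatest_spec (P := fun m => m ^ 4 * E ≤ x) hx (by simpa using h), ?_⟩
  set m := Nat.findGreatest (fun m => m ^ 4 * E ≤ x) x
  have hm : 1 ≤ m := Nat.le_findGreatest hx (by simpa using h)
  by_cases hmx : m + 1 ≤ x
  · have := Nat.findGreatest_is_greatest (P := fun m => m ^ 4 * E ≤ x) (Nat.lt_succ_self m) hmx
    calc x ≤ (m + 1) ^ 4 * E := (not_le.1 this).le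
      _ ≤ (2 * m) ^ 4 * E := by gcongr; omega
      _ = 16 * m ^ 4 * E := by ring
  · calc x ≤ m := by omega
      _ ≤ m ^ 4 := Nat.le_self_pow (by norm_num) _
      _ ≤ 16 * m ^ 4 * E := by nlinarith [Nat.zero_le (m ^ 4)]

/-- The combination of the trivial bound and the cluster bound. -/
theorem pow_mul_pow_le_of_bounds {x n d E m : ℕ} (hE : 0 < E) (hEx : E ≤ x ^ 3) (hm : 1 ≤ m)
    (hm1 : m ^ 4 * E ≤ x ^ 3) (hm2 : x ^ 3 ≤ 16 * m ^ 4 * E) (htriv : x ^ 4 ≤ d * E)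
    (hclu : n / (2 * m) * (m ^ 2 * x ^ 2) ≤ 2 * d ^ 2) :
    x ^ 11 * n ^ 4 ≤ 2 ^ 16 * (d ^ 8 * E) := by
  rcases le_total (2 * m) n with h | h
  · have hk : 1 ≤ n / (2 * m) := (Nat.one_le_div_iff (by omega)).2 h
    have hn : n ≤ 4 * m * (n / (2 * m)) := by
      have h1 := Nat.div_add_mod n (2 * m)
      have h2 := Nat.mod_lt n (show 0 < 2 * m by omega)
      nlinarith
    have h3 : n * m * x ^ 2 ≤ 8 * d ^ 2 := by
      calc n * m * x ^ 2 ≤ 4 * m * (n / (2 * m)) * m * x ^ 2 := by gcongr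
        _ = 4 * (n / (2 * m) * (m ^ 2 * x ^ 2)) := by ring
        _ ≤ 4 * (2 * d ^ 2) := by gcongr
        _ = 8 * d ^ 2 := by ring
    calc x ^ 11 * n ^ 4 = n ^ 4 * x ^ 8 * x ^ 3 := by ring
      _ ≤ n ^ 4 * x ^ 8 * (16 * m ^ 4 * E) := by gcongr
      _ = 16 * E * (n * m * x ^ 2) ^ 4 := by ring
      _ ≤ 16 * E * (8 * d ^ 2) ^ 4 := by gcongr
      _ = 2 ^ 16 * (d ^ 8 * E) := by ring
  · have hx : 1 ≤ x := by
      rcases Nat.eq_zero_or_pos x with rfl | h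
      · simp at hEx; omega
      · exact h
    refine Nat.le_of_mul_le_mul_left ?_ (pow_pos hE 7)
    calc E ^ 7 * (x ^ 11 * n ^ 4) ≤ E ^ 7 * (x ^ 11 * (2 * m) ^ 4) := by gcongr
      _ = 16 * E ^ 6 * x ^ 11 * (m ^ 4 * E) := by ring
      _ ≤ 16 * (x ^ 3) ^ 6 * x ^ 11 * x ^ 3 := by gcongr
      _ = 16 * (x ^ 4) ^ 8 := by ring
      _ ≤ 16 * (d * E) ^ 8 := by gcongr
      _ ≤ 2 ^ 16 * (d * E) ^ 8 := by gcongr; norm_num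
      _ = E ^ 7 * (2 ^ 16 * (d ^ 8 * E)) := by ring

/-- There is an absolute constant `c > 0` such that for all finite nonempty sets `A`, `X`
of positive reals, `|AX+AX| ≥ c·|X|·|A/A|^(1/2)·K^(1/8)` with `K = |X|³/E₊(X)`;
equivalently, `|AX+AX|⁸·E₊(X) ≥ c⁸·|X|^11·|A/A|⁴`. -/
theorem lower_bound_AX_add_AX :
    ∃ c : ℝ, 0 < c ∧
      ∀ A X : Finset ℝ, A.Nonempty → X.Nonempty →
        (∀ a ∈ A, 0 < a) → (∀ x ∈ X, 0 < x) →
        c ^ 8 * (X.card : ℝ) ^ 11 *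
            ((((A ×ˢ A.filter (fun b => b ≠ 0)).image
              (fun p : ℝ × ℝ => p.1 / p.2)).card : ℝ)) ^ 4 ≤
          ((((A ×ˢ X ×ˢ A ×ˢ X).image
              (fun p : ℝ × ℝ × ℝ × ℝ => p.1 * p.2.1 + p.2.2.1 * p.2.2.2)).card : ℝ)) ^ 8 *
            (addEnergy X : ℝ) := by
  refine ⟨1 / 4, by norm_num, fun A X hA hX hApos hXpos => ?_⟩
  set Q := (A ×ˢ A.filter (fun b => b ≠ 0)).image (fun p : ℝ × ℝ => p.1 / p.2)
  set D := (A ×ˢ X ×ˢ A ×ˢ X).image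
    (fun p : ℝ × ℝ × ℝ × ℝ => p.1 * p.2.1 + p.2.2.1 * p.2.2.2)
  have hDmem : ∀ a ∈ A, ∀ x ∈ X, ∀ a' ∈ A, ∀ x' ∈ X, a * x + a' * x' ∈ D :=
    fun a ha x hx a' ha' x' hx' =>
      mem_image.2 ⟨(a, x, a', x'), by simp only [mem_product]; exact ⟨ha, hx, ha', hx'⟩, rfl⟩
  have hslope : ∀ s, ∃ b, s ∈ Q → b ∈ A ∧ s * b ∈ A := by
    intro s
    by_cases hs : s ∈ Q
    · obtain ⟨⟨a, b⟩, hab, rfl⟩ := mem_image.1 hs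
      simp only [mem_product, mem_filter] at hab
      exact ⟨b, fun _ => ⟨hab.2.1, by rw [div_mul_cancel₀ _ hab.2.2]; exact hab.1⟩⟩
    · exact ⟨0, fun h => absurd h hs⟩
  choose b hb using hslope
  obtain ⟨a, ha⟩ := hA
  have hE := addEnergy_pos hX
  have hEx := addEnergy_le_card_cube X
  have htriv := card_pow_four_le_mul_addEnergy X D (hApos a ha).ne'
    (fun x hx y hy => hDmem a ha x hx a ha y hy)
  obtain ⟨m, hm, hm1, hm2⟩ := exists_pow_four_mul_le_lt hE hEx
  have hclu := card_div_mul_le_of_slopes X Q D b m hm hX hXpos hm1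
    (fun s hs => hApos _ (hb s hs).1) (by
      intro s hs t ht x hx y hy
      simp only [lineSum, mem_product, ← mul_assoc]
      exact ⟨hDmem _ (hb s hs).1 x hx _ (hb t ht).1 y hy,
        hDmem _ (hb s hs).2 x hx _ (hb t ht).2 y hy⟩)
  have hfin : (X.card : ℝ) ^ 11 * (Q.card : ℝ) ^ 4 ≤
      2 ^ 16 * ((D.card : ℝ) ^ 8 * (addEnergy X : ℝ)) := by
    exact_mod_cast pow_mul_pow_le_of_bounds hE hEx hm hm1 hm2 htriv hclu
  have hc : (1 / 4 : ℝ) ^ 8 = 1 / 2 ^ 16 := by norm_num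
  rw [hc]
  linarith
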